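/- arXiv:1306.0254 — 3 statements merged into one kernel-verified Lean document; each statement's English description precedes it below -/
import Mathlib

section
/- Let b : (0,∞) → ℝ be a real-valued function. As x → +∞ one has the expansion log(Γ(x + b(x))/Γ(x)) = b(x)·log x + (b(x)² − b(x))/(2x) + c(x), where the error term satisfies: c(x) = O(x^{-1/2}) if b(x) = O(√x) as x → +∞, and c(x) = O(x^{-2}) if b(x) = O(1) as x → +∞. -/
open Filter Asymptotics


noncomputable def psiR (x : ℝ) : ℝ := deriv (fun y => Real.log (Real.Gamma y)) x

lemma psiR_hasDerivAt {x : ℝ} (hx : 0 < x) :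
    HasDerivAt (fun y => Real.log (Real.Gamma y)) (psiR x) x := by
  have h : DifferentiableAt ℝ Real.Gamma x := by
    apply Real.differentiableAt_Gamma
    intro m hm
    have : (0 : ℝ) ≤ m := Nat.cast_nonneg m
    linarith
  exact (h.log (Real.Gamma_pos_of_pos hx).ne').hasDerivAt

lemma logGamma_succ {x : ℝ} (hx : 0 < x) :
    Real.log (Real.Gamma (x + 1)) = Real.log (Real.Gamma x) + Real.log x := by
  rw [Real.Gamma_add_one hx.ne', Real.log_mul hx.ne' (Real.Gamma_pos_of_pos hx).ne']
  ring

lemma psiR_succ {x : ℝ} (hx : 0 < x) : psiR (x + 1) = psiR x + 1 / x := by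
  have h1 : HasDerivAt (fun y => Real.log (Real.Gamma (y + 1))) (psiR (x + 1)) x :=
    HasDerivAt.comp_add_const x 1 (psiR_hasDerivAt (by linarith))
  have h2 : HasDerivAt (fun y => Real.log (Real.Gamma y) + Real.log y) (psiR x + x⁻¹) x :=
    (psiR_hasDerivAt hx).add (Real.hasDerivAt_log hx.ne')
  have h3 : HasDerivAt (fun y => Real.log (Real.Gamma (y + 1))) (psiR x + x⁻¹) x := by
    apply h2.congr_of_eventuallyEq
    filter_upwards [lt_mem_nhds hx] with y hy
    exact logGamma_succ hy
  rw [one_div]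
  exact h1.unique h3

lemma psiR_le {x : ℝ} (hx : 0 < x) : psiR x ≤ Real.log x := by
  have h := Real.convexOn_log_Gamma.le_slope_of_hasDerivAt (x := x) (y := x + 1) hx
    (show (0:ℝ) < x + 1 by linarith) (by linarith) (psiR_hasDerivAt hx)
  simp only [slope_def_field, Function.comp_apply, logGamma_succ hx] at h
  simpa using h

lemma le_psiR {x : ℝ} (hx : 0 < x) : Real.log x - 1 / x ≤ psiR x := by
  have h := Real.convexOn_log_Gamma.slope_le_of_hasDerivAt (x := x) (y := x + 1) hx
    (show (0:ℝ) < x + 1 by linarith) (by linarith) (psiR_hasDerivAt (by linarith))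
  simp only [slope_def_field, Function.comp_apply, logGamma_succ hx, psiR_succ hx] at h
  have h' : Real.log x ≤ psiR x + 1 / x := by simpa using h
  linarith

noncomputable def gR (x : ℝ) : ℝ := psiR x - Real.log x + 1 / (2 * x)

lemma gR_abs {x : ℝ} (hx : 0 < x) : |gR x| ≤ 1 / (2 * x) := by
  have h1 := psiR_le hx
  have h2 := le_psiR hx
  have h3 : 1 / x = 1 / (2 * x) + 1 / (2 * x) := by field_simp; norm_num
  unfold gR
  rw [abs_le]
  constructor <;> linarith

lemma log_succ_bounds {x : ℝ} (hx : 0 < x) :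
    2 / (2 * x + 1) ≤ Real.log (x + 1) - Real.log x ∧
    Real.log (x + 1) - Real.log x ≤ (1 / x + 1 / (x + 1)) / 2 := by
  have e : Real.log (x + 1) - Real.log x = Real.log (1 + 1 / x) := by
    rw [← Real.log_div (by linarith) hx.ne']
    congr 1
    field_simp
  rw [e]
  have hp : 0 < 1 / x := by positivity
  constructor
  · have := Real.le_log_one_add_of_nonneg hp.le
    refine le_trans (le_of_eq ?_) this
    field_simp
    ring
  · have h0 : 0 ≤ Real.log (1 + 1 / x) := Real.log_nonneg (by linarith)
    have := Real.self_le_sinh_iff.2 h0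
    rw [Real.sinh_log (by positivity)] at this
    refine this.trans (le_of_eq ?_)
    field_simp
    ring

lemma gR_step {x : ℝ} (hx : 0 < x) :
    gR x ≤ gR (x + 1) ∧ gR (x + 1) + 1 / (x + 1) ^ 2 ≤ gR x + 1 / x ^ 2 := by
  obtain ⟨h1, h2⟩ := log_succ_bounds hx
  have e : gR (x + 1) = gR x + ((1 / x + 1 / (x + 1)) / 2 - (Real.log (x + 1) - Real.log x)) := by
    unfold gR
    rw [psiR_succ hx]
    field_simp
    ring
  constructor
  · linarith
  · have k : (1 / x + 1 / (x + 1)) / 2 - 2 / (2 * x + 1) ≤ 1 / x ^ 2 - 1 / (x + 1) ^ 2 := by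
      have e1 : (1 / x + 1 / (x + 1)) / 2 - 2 / (2 * x + 1)
          = 1 / (2 * x * (x + 1) * (2 * x + 1)) := by
        field_simp
        ring
      have e2 : 1 / x ^ 2 - 1 / (x + 1) ^ 2 = (2 * x + 1) / (x ^ 2 * (x + 1) ^ 2) := by
        field_simp
        ring
      rw [e1, e2, div_le_div_iff₀ (by positivity) (by positivity)]
      have : 0 ≤ x * (x + 1) * (2 * (2 * x + 1) ^ 2 - x * (x + 1)) := by
        apply mul_nonneg (by positivity)
        nlinarith
      nlinarith
    linarith

lemma gR_bounds {x : ℝ} (hx : 0 < x) : gR x ≤ 0 ∧ -(1 / x ^ 2) ≤ gR x := by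
  have hxn : ∀ n : ℕ, 0 < x + n := fun n => by positivity
  have hinf : Tendsto (fun n : ℕ => x + (n : ℝ)) atTop atTop :=
    tendsto_atTop_add_const_left _ _ tendsto_natCast_atTop_atTop
  have hinv : Tendsto (fun n : ℕ => 1 / (x + (n : ℝ))) atTop (nhds 0) := by
    simp only [one_div]
    exact hinf.inv_tendsto_atTop
  have hg : Tendsto (fun n : ℕ => gR (x + n)) atTop (nhds 0) := by
    apply squeeze_zero_norm (a := fun n : ℕ => 1 / (x + (n : ℝ))) _ hinv
    intro n
    refine (gR_abs (hxn n)).trans ?_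
    have := hxn n
    apply one_div_le_one_div_of_le this
    linarith
  have hu : Tendsto (fun n : ℕ => gR (x + n) + 1 / (x + (n : ℝ)) ^ 2) atTop (nhds 0) := by
    have := hg.add (hinv.pow 2)
    simpa using this
  constructor
  · apply ge_of_tendsto' hg
    intro n
    induction n with
    | zero => simp
    | succ n ih =>
      have := (gR_step (hxn n)).1
      push_cast
      rw [← add_assoc]
      linarith
  · have : 0 ≤ gR x + 1 / x ^ 2 := by
      apply le_of_tendsto' hu
      intro n
      induction n with
      | zero => simp
      | succ n ih =>
        have := (gR_step (hxn n)).2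
        push_cast
        rw [← add_assoc]
        linarith
    linarith

lemma log_quad {t : ℝ} (ht : |t| ≤ 1 / 2) : |Real.log (1 + t) - t| ≤ 2 * t ^ 2 := by
  have h := Real.abs_log_sub_add_sum_range_le (x := -t) (by rw [abs_neg]; linarith) 1
  simp only [Finset.sum_range_one, abs_neg, sub_neg_eq_add] at h
  norm_num at h
  have e : -t + Real.log (1 + t) = Real.log (1 + t) - t := by ring
  rw [e] at h
  refine h.trans ?_
  rw [div_le_iff₀ (by linarith)]
  nlinarith [sq_nonneg t]

lemma main_bound {x b B : ℝ} (hx : 0 < x) (hb : |b| ≤ B) (hB : B ≤ x / 2) :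
    |Real.log (Real.Gamma (x + b) / Real.Gamma x)
        - (b * Real.log x + (b ^ 2 - b) / (2 * x))| ≤ (2 * B ^ 2 + B + 4) / x ^ 2 * B := by
  have hB0 : 0 ≤ B := (abs_nonneg b).trans hb
  have hpos : ∀ s ∈ Set.Icc (-B) B, x / 2 ≤ x + s := fun s hs => by linarith [hs.1]
  have key := Convex.norm_image_sub_le_of_norm_hasDerivWithin_le
    (f := fun s => Real.log (Real.Gamma (x + s)) - (s * Real.log x + (s ^ 2 - s) / (2 * x)))
    (f' := fun s => psiR (x + s) - (Real.log x + (2 * s - 1) / (2 * x)))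
    (s := Set.Icc (-B) B) (x := 0) (y := b) (C := (2 * B ^ 2 + B + 4) / x ^ 2)
    (by
      intro s hs
      apply HasDerivAt.hasDerivWithinAt
      have h1 : HasDerivAt (fun s => Real.log (Real.Gamma (x + s))) (psiR (x + s)) s :=
        HasDerivAt.comp_const_add x s (psiR_hasDerivAt (by linarith [hpos s hs]))
      have h2 : HasDerivAt (fun s : ℝ => s * Real.log x) (Real.log x) s := by
        simpa using (hasDerivAt_id s).mul_const (Real.log x)
      have h3 : HasDerivAt (fun s : ℝ => (s ^ 2 - s) / (2 * x)) ((2 * s - 1) / (2 * x)) s := by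
        have := ((hasDerivAt_pow 2 s).sub (hasDerivAt_id s)).div_const (2 * x)
        simpa using this
      exact h1.sub (h2.add h3))
    (by
      intro s hs
      have hp := hpos s hs
      have hxs : 0 < x + s := by linarith
      have hsB : |s| ≤ B := abs_le.2 hs
      have hlog : Real.log (x + s) = Real.log x + Real.log (1 + s / x) := by
        have : 1 + s / x = (x + s) / x := by field_simp
        rw [this, Real.log_div hxs.ne' hx.ne']
        ring
      have e : psiR (x + s) - (Real.log x + (2 * s - 1) / (2 * x))
          = (Real.log (1 + s / x) - s / x) + s / (2 * x * (x + s)) + gR (x + s) := by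
        unfold gR
        rw [hlog]
        field_simp
        ring
      have b1 : |Real.log (1 + s / x) - s / x| ≤ 2 * B ^ 2 / x ^ 2 := by
        have ht : |s / x| ≤ 1 / 2 := by
          rw [abs_div, abs_of_pos hx, div_le_iff₀ hx]
          linarith
        refine (log_quad ht).trans ?_
        rw [div_pow, mul_div_assoc]
        have : s ^ 2 ≤ B ^ 2 := sq_le_sq' hs.1 hs.2
        gcongr
      have b2 : |s / (2 * x * (x + s))| ≤ B / x ^ 2 := by
        rw [abs_div, abs_of_pos (show 0 < 2 * x * (x + s) by positivity)]
        apply div_le_div₀ hB0 hsB (by positivity)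
        nlinarith
      have b3 : |gR (x + s)| ≤ 4 / x ^ 2 := by
        obtain ⟨g1, g2⟩ := gR_bounds hxs
        rw [abs_of_nonpos g1]
        have : 1 / (x + s) ^ 2 ≤ 4 / x ^ 2 := by
          rw [div_le_div_iff₀ (by positivity) (by positivity)]
          nlinarith
        linarith
      rw [Real.norm_eq_abs, e]
      refine (abs_add_three _ _ _).trans ?_
      rw [add_div, add_div]
      linarith)
    (convex_Icc _ _) ⟨by linarith, hB0⟩ (abs_le.1 hb)
  have hxb : 0 < x + b := by linarith [(abs_le.1 hb).1]
  rw [Real.log_div (Real.Gamma_pos_of_pos hxb).ne' (Real.Gamma_pos_of_pos hx).ne']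
  simp only [Real.norm_eq_abs, sub_zero, add_zero] at key
  have e : Real.log (Real.Gamma (x + b)) - Real.log (Real.Gamma x)
        - (b * Real.log x + (b ^ 2 - b) / (2 * x))
      = Real.log (Real.Gamma (x + b)) - (b * Real.log x + (b ^ 2 - b) / (2 * x))
        - (Real.log (Real.Gamma x) - (0 * Real.log x + (0 ^ 2 - 0) / (2 * x))) := by ring
  rw [e]
  norm_num at key ⊢
  refine key.trans ?_
  gcongr

/-- Jiang–Yang, Lemma 5.1 (first part): asymptotic expansion of
`log (Γ(x + b x) / Γ x)` as `x → +∞`, with error `O(x^{-1/2})` when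
`b(x) = O(√x)` and error `O(x^{-2})` when `b(x) = O(1)`. -/
theorem stmt_0 (b : ℝ → ℝ) (c : ℝ → ℝ)
    (hc : ∀ x : ℝ, c x =
      Real.log (Real.Gamma (x + b x) / Real.Gamma x)
        - (b x * Real.log x + (b x ^ 2 - b x) / (2 * x))) :
    (b =O[atTop] (fun x => Real.sqrt x) →
        c =O[atTop] (fun x => (Real.sqrt x)⁻¹)) ∧
    (b =O[atTop] (fun _ => (1 : ℝ)) →
        c =O[atTop] (fun x => (x ^ 2)⁻¹)) := by
  constructor
  · intro hb
    obtain ⟨C, hC1, hC⟩ := hb.exists_pos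
    rw [IsBigOWith_def] at hC
    set D := max C 1 with hD
    have hD1 : 1 ≤ D := le_max_right _ _
    have hCD : C ≤ D := le_max_left _ _
    apply IsBigO.of_bound (7 * D ^ 3)
    filter_upwards [hC, eventually_ge_atTop ((2 * D) ^ 2)] with x hx hxl
    have hx1 : 1 ≤ x := by nlinarith
    have hx0 : 0 < x := by linarith
    have hs : 2 * D ≤ Real.sqrt x := Real.le_sqrt_of_sq_le hxl
    have hsq : Real.sqrt x * Real.sqrt x = x := Real.mul_self_sqrt hx0.le
    simp only [Real.norm_eq_abs, abs_of_nonneg (Real.sqrt_nonneg x)] at hx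
    set s := Real.sqrt x with hsdef
    have hspos : 0 < s := by linarith
    have hbB : |b x| ≤ D * s := hx.trans (by gcongr)
    have hDs1 : 1 ≤ D * s := by nlinarith
    have key := main_bound (b := b x) hx0 hbB (by nlinarith)
    rw [Real.norm_eq_abs, Real.norm_eq_abs, hc x, abs_of_pos (inv_pos.2 hspos)]
    refine key.trans ?_
    have h7 : 2 * (D * s) ^ 2 + D * s + 4 ≤ 7 * (D * s) ^ 2 := by nlinarith
    calc _ ≤ 7 * (D * s) ^ 2 / x ^ 2 * (D * s) := by gcongr
      _ = 7 * D ^ 3 * s⁻¹ := by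
        rw [← hsq]
        field_simp
  · intro hb
    obtain ⟨C, hC1, hC⟩ := hb.exists_pos
    rw [IsBigOWith_def] at hC
    apply IsBigO.of_bound ((2 * C ^ 2 + C + 4) * C)
    filter_upwards [hC, eventually_ge_atTop (2 * C)] with x hx hxl
    have hx0 : 0 < x := by linarith
    have key := main_bound (b := b x) (B := C) hx0 (by simpa using hx) (by linarith)
    rw [Real.norm_eq_abs, Real.norm_eq_abs, hc x,
      abs_of_pos (show 0 < (x ^ 2)⁻¹ by positivity)]
    refine key.trans (le_of_eq ?_)
    rw [div_eq_mul_inv]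
    ring
end

section
/- Fix a > 0 and define η(t) = sup_{x ≥ a} |log(Γ(x + t)/Γ(x)) − t·log x| for all t > −a. Then lim_{t → 0} η(t) = 0. -/
open Filter Topology

lemma aux_feq {y : ℝ} (hy : 0 < y) :
    Real.log (Real.Gamma (y + 1)) = Real.log (Real.Gamma y) + Real.log y := by
  rw [Real.Gamma_add_one hy.ne', Real.log_mul hy.ne' (Real.Gamma_pos_of_pos hy).ne', add_comm]

lemma aux_log {x t : ℝ} (hx : 0 < x) (ht : 0 < t) :
    Real.log (x + t) - Real.log x ≤ t / x := by
  rw [← Real.log_div (by positivity) hx.ne']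
  have h := Real.log_le_sub_one_of_pos (show 0 < (x + t) / x by positivity)
  have e : (x + t) / x - 1 = t / x := by field_simp; ring
  linarith

lemma aux_up {x t : ℝ} (hx : 0 < x) (ht : 0 < t) (ht1 : t < 1) :
    Real.log (Real.Gamma (x + t)) - Real.log (Real.Gamma x) ≤ t * Real.log x := by
  have h := Real.convexOn_log_Gamma.2 (show x ∈ Set.Ioi (0 : ℝ) from hx)
    (show x + 1 ∈ Set.Ioi (0 : ℝ) from by simp only [Set.mem_Ioi]; linarith)
    (show 0 ≤ 1 - t by linarith) ht.le (by ring)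
  simp only [smul_eq_mul, Function.comp] at h
  rw [show (1 - t) * x + t * (x + 1) = x + t by ring, aux_feq hx] at h
  linarith

lemma aux_low {x t : ℝ} (hx : 0 < x) (ht : 0 < t) :
    t * Real.log x - t / x ≤ Real.log (Real.Gamma (x + t)) - Real.log (Real.Gamma x) := by
  have h := Real.convexOn_log_Gamma.slope_mono_adjacent (show x ∈ Set.Ioi (0 : ℝ) from hx)
    (show x + t + 1 ∈ Set.Ioi (0 : ℝ) from by simp only [Set.mem_Ioi]; linarith)
    (show x < x + 1 by linarith) (show x + 1 < x + t + 1 by linarith)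
  simp only [Function.comp] at h
  rw [show x + 1 - x = 1 by ring, show x + t + 1 - (x + 1) = t by ring, aux_feq hx,
    aux_feq (show 0 < x + t by linarith), div_one, le_div_iff₀ ht] at h
  have := aux_log hx ht
  linarith

lemma aux_main {a x t : ℝ} (ha : 0 < a) (hx : a ≤ x) (ht0 : t ≠ 0) (ht1 : |t| < 1)
    (hta : |t| < a / 2) :
    |Real.log (Real.Gamma (x + t) / Real.Gamma x) - t * Real.log x| ≤ 4 / a * |t| := by
  have hx0 : 0 < x := by linarith
  have hxt : 0 < x + t := by linarith [neg_abs_le t]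
  rw [Real.log_div (Real.Gamma_pos_of_pos hxt).ne' (Real.Gamma_pos_of_pos hx0).ne']
  have key : ∀ s y : ℝ, 0 < s → a / 2 ≤ y → s / y ≤ 2 / a * s := by
    intro s y hs hy
    calc s / y ≤ s / (a / 2) := by gcongr
      _ = _ := by field_simp
  have e : 4 / a * |t| = 2 * (2 / a * |t|) := by ring
  have hp : 0 ≤ 2 / a * |t| := by positivity
  rw [e]
  rcases lt_or_gt_of_ne ht0 with h | h
  · have hs : 0 < -t := by linarith
    rw [abs_of_neg h] at *
    have hy : a / 2 ≤ x + t := by linarith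
    have h1 := aux_up hxt hs ht1
    have h2 := aux_low hxt hs
    have h3 := aux_log hxt hs
    have h4 := key _ _ hs hy
    rw [show x + t + -t = x by ring] at h1 h2 h3
    have h5 : 0 ≤ Real.log x - Real.log (x + t) :=
      sub_nonneg.2 (Real.log_le_log hxt (by linarith))
    have h6 : (-t) * (Real.log x - Real.log (x + t)) ≤ 2 / a * -t := by nlinarith
    have h7 : 0 ≤ (-t) * (Real.log x - Real.log (x + t)) := by positivity
    rw [abs_le]
    constructor <;> linarith
  · rw [abs_of_pos h] at *
    have h1 := aux_up hx0 h ht1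
    have h2 := aux_low hx0 h
    have h4 := key t x h (by linarith)
    rw [abs_le]
    constructor <;> linarith

/-- Jiang–Yang, Lemma 5.2: with `a > 0` and
`η(t) = sup_{x ≥ a} |log (Γ(x + t)/Γ x) − t·log x|` for `t > −a`,
one has `η(t) → 0` as `t → 0`. -/
theorem stmt_2 (a : ℝ) (ha : 0 < a) (η : ℝ → ℝ)
    (hη : ∀ t : ℝ, -a < t → η t =
      ⨆ x : Set.Ici a,
        |Real.log (Real.Gamma ((x : ℝ) + t) / Real.Gamma (x : ℝ)) - t * Real.log (x : ℝ)|) :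
    Tendsto η (𝓝[≠] (0 : ℝ)) (𝓝 0) := by
  have hlim : Tendsto (fun t : ℝ => 4 / a * |t|) (𝓝[≠] (0 : ℝ)) (𝓝 0) := by
    have : Continuous (fun t : ℝ => 4 / a * |t|) := by fun_prop
    have h := this.tendsto 0
    simp only [abs_zero, mul_zero] at h
    exact h.mono_left nhdsWithin_le_nhds
  have habs : Tendsto (fun t : ℝ => |t|) (𝓝[≠] (0 : ℝ)) (𝓝 0) := by
    have h := (continuous_abs (G := ℝ)).tendsto 0
    simp only [abs_zero] at h
    exact h.mono_left nhdsWithin_le_nhds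
  have e1 := habs.eventually (gt_mem_nhds (show (0 : ℝ) < 1 by norm_num))
  have e2 := habs.eventually (gt_mem_nhds (show (0 : ℝ) < a / 2 by linarith))
  refine tendsto_of_tendsto_of_tendsto_of_le_of_le' tendsto_const_nhds hlim ?_ ?_
  · filter_upwards [e2] with t h2
    rw [hη t (by linarith [neg_abs_le t])]
    exact Real.iSup_nonneg fun x => abs_nonneg _
  · filter_upwards [e1, e2, self_mem_nhdsWithin] with t h1 h2 h3
    rw [hη t (by linarith [neg_abs_le t])]
    exact Real.iSup_le (fun x => aux_main ha x.2 h3 h1 h2) (by positivity)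
end

section
/- Let p = p_n be a sequence of positive integers with n > p_n + 1 for all n ≥ 3 and p_n/n → y ∈ (0, 1] as n → ∞. For each n, let Z be an (n−1) × p random matrix whose entries are independent standard normal random variables, let W = ZᵀZ, and let V_n = det(W) · (tr(W)/p)^{−p}. Define μ_n = −p − (n − p − 3/2)·log(1 − p/(n−1)) and σ_n² = −2[ p/(n−1) + log(1 − p/(n−1)) ]. Then (log V_n − μ_n)/σ_n converges in distribution to the standard normal distribution N(0,1) as n → ∞. -/
open Filter Topology MeasureTheory ProbabilityTheory Matrix

/-- The logarithm of Mauchly's sphericity statistic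
`V = det(W) · (tr(W)/q)^{−q}`, `W = Zᵀ Z`, computed from an `m × q` data array `ω`. -/
noncomputable def logSphericityStat (m q : ℕ) (ω : Fin m × Fin q → ℝ) : ℝ :=
  let Z : Matrix (Fin m) (Fin q) ℝ := Matrix.of fun i j => ω (i, j)
  Real.log ((Zᵀ * Z).det * (((Zᵀ * Z).trace / q) ^ (-(q : ℤ))))

open Filter Topology MeasureTheory ProbabilityTheory Matrix

noncomputable def gC (E : Type*) [NormedAddCommGroup E] [InnerProductSpace ℝ E] : ℝ :=
  ((2 * Real.pi) ^ (Module.finrank ℝ E / 2 : ℝ))⁻¹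

lemma gC_pos {E : Type*} [NormedAddCommGroup E] [InnerProductSpace ℝ E] : 0 < gC E := by
  unfold gC; positivity

section gaussE
variable {E : Type*} [NormedAddCommGroup E] [InnerProductSpace ℝ E] [FiniteDimensional ℝ E]
  [MeasurableSpace E] [BorelSpace E]

noncomputable def gD (r : ℝ) : ℝ := Real.exp (-(1/2) * r ^ 2)

lemma gD_integral : ∫ x : E, gD ‖x‖ = (gC E)⁻¹ := by
  unfold gD gC
  rw [GaussianFourier.integral_rexp_neg_mul_sq_norm (by norm_num)]
  rw [inv_inv]; congr 1; ring

lemma gD_integrable : Integrable (fun x : E => gC E * gD ‖x‖) := by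
  apply Integrable.const_mul
  by_contra h
  have := gD_integral (E := E)
  rw [integral_undef h] at this
  have := gC_pos (E := E)
  simp_all

lemma stdGaussian_density : stdGaussian E =
    (volume : Measure E).withDensity (fun x => ENNReal.ofReal (gC E * gD ‖x‖)) := by
  have hfin : IsFiniteMeasure ((volume : Measure E).withDensity
      (fun x => ENNReal.ofReal (gC E * gD ‖x‖))) :=
    isFiniteMeasure_withDensity_ofReal gD_integrable.2
  apply Measure.ext_of_charFun
  ext t
  rw [charFun_stdGaussian, charFun_apply, integral_withDensity_eq_integral_toReal_smul]
  · have h1 := GaussianFourier.integral_cexp_neg_mul_sq_norm_add (V := E) (b := 1/2) (by norm_num) Complex.I t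
    have : ∀ x : E, (ENNReal.ofReal (gC E * gD ‖x‖)).toReal • Complex.exp (inner ℝ x t * Complex.I)
       = (gC E : ℂ) * Complex.exp (-(1/2) * ‖x‖^2 + Complex.I * inner ℝ t x) := by
      intro x
      have : 0 ≤ gC E * gD ‖x‖ := by
        have := gC_pos (E := E)
        unfold gD; positivity
      rw [ENNReal.toReal_ofReal this, real_inner_comm, Complex.real_smul, Complex.exp_add, gD]
      push_cast
      ring_nf
    simp_rw [this]
    rw [integral_const_mul, h1, ← mul_assoc]
    have : (gC E : ℂ) * ((Real.pi : ℂ) / (1/2)) ^ (Module.finrank ℝ E / 2 : ℂ) = 1 := by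
      have h2 : ((Real.pi : ℂ) / (1/2)) ^ (Module.finrank ℝ E / 2 : ℂ) = (((2 * Real.pi) ^ (Module.finrank ℝ E / 2 : ℝ) : ℝ) : ℂ) := by
        rw [Complex.ofReal_cpow (by positivity)]
        push_cast
        congr 1; ring
      rw [h2, gC, ← Complex.ofReal_mul, inv_mul_cancel₀ (by positivity)]; simp
    rw [this, one_mul]
    simp; ring_nf
  · unfold gD; fun_prop
  · simp

lemma stdGaussian_integral (f : E → ℂ) :
    ∫ x, f x ∂stdGaussian E = gC E * ∫ x, (gD ‖x‖ : ℂ) * f x := by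
  rw [stdGaussian_density, integral_withDensity_eq_integral_toReal_smul]
  · rw [← integral_const_mul]
    congr 1
    ext x
    have : 0 ≤ gC E * gD ‖x‖ := by
        have := gC_pos (E := E)
        unfold gD; positivity
    rw [ENNReal.toReal_ofReal this, Complex.real_smul]; push_cast; ring
  · unfold gD; fun_prop
  · simp

lemma polar_prod [Nontrivial E] (g : E → ℂ) (hg : ∀ (r : ℝ) x, 0 < r → g (r • x) = g x) :
    ∃ A : ℂ, ∀ h : ℝ → ℂ, ∫ x : E, h ‖x‖ * g x =
      A * ∫ y : Set.Ioi (0:ℝ), h y ∂(.volumeIoiPow (Module.finrank ℝ E - 1)) := by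
  refine ⟨∫ x : Metric.sphere (0:E) 1, g x ∂((volume : Measure E).toSphere), fun h => ?_⟩
  set μ := (volume : Measure E)
  calc
    ∫ x, h ‖x‖ * g x ∂μ = ∫ x : ({(0)}ᶜ : Set E), h (‖x.1‖) * g x.1 ∂(μ.comap (↑)) := by
      rw [integral_subtype_comap (measurableSet_singleton _).compl fun x ↦ h (‖x‖) * g x,
        restrict_compl_singleton]
    _ = ∫ x, g x.1 * h x.2 ∂μ.toSphere.prod (.volumeIoiPow (Module.finrank ℝ E - 1)) := by
      rw [← μ.measurePreserving_homeomorphUnitSphereProd.integral_comp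
        (Homeomorph.measurableEmbedding _)]
      congr 1
      ext x
      have hx : 0 < ‖x.1‖ := norm_pos_iff.2 x.2
      simp [hg _ _ (inv_pos.2 hx), mul_comm]
    _ = _ := by
      rw [integral_prod_mul (f := fun x : Metric.sphere (0:E) 1 => g x) (g := fun y : Set.Ioi (0:ℝ) => h y)]

lemma basu [Nontrivial E] (g : E → ℂ) (hg : ∀ (r : ℝ) x, 0 < r → g (r • x) = g x) (h : ℝ → ℂ) :
    ∫ x, h ‖x‖ * g x ∂stdGaussian E =
      (∫ x, h ‖x‖ ∂stdGaussian E) * ∫ x, g x ∂stdGaussian E := by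
  obtain ⟨A, hA⟩ := polar_prod g hg
  obtain ⟨B, hB⟩ := polar_prod (fun _ : E => (1:ℂ)) (by simp)
  have h1 : ∫ x : E, (1:ℂ) ∂stdGaussian E = 1 := by simp
  simp only [mul_one] at hB
  rw [stdGaussian_integral] at h1 ⊢
  simp only [mul_one] at h1
  rw [stdGaussian_integral, stdGaussian_integral]
  have e1 := hA (fun r => gD r * h r)
  have e2 := hA (fun r => gD r)
  have e3 := hB (fun r => gD r * h r)
  have e4 := hB (fun r => gD r)
  simp only [← mul_assoc]
  rw [e1, e2, e3]
  rw [e4] at h1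
  linear_combination (-(gC E) * A * ∫ (y : ↑(Set.Ioi (0:ℝ))), (gD y : ℂ) * h y ∂Measure.volumeIoiPow (Module.finrank ℝ E - 1)) * h1

noncomputable def RR (d : ℕ) (s : ℝ) : ℂ :=
  Complex.exp (Complex.I * s * Real.log 2) * (Complex.Gamma (d / 2 + Complex.I * s) / Complex.Gamma (d / 2))

lemma radial_aux (d : ℕ) (hd : 0 < d) (s : ℝ) :
    ∫ y in Set.Ioi (0:ℝ), y ^ (d - 1) • ((gD y : ℂ) * Complex.exp (Complex.I * s * Real.log (y^2)))
     = (1/2) * ((2:ℂ) ^ (d / 2 + Complex.I * s) * Complex.Gamma (d / 2 + Complex.I * s)) := by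
  have h := Complex.integral_cpow_mul_exp_neg_mul_Ioi (a := d / 2 + Complex.I * s) (r := 1/2)
    (by simp; positivity) (by norm_num)
  rw [show (1 / ((1/2 : ℝ) : ℂ) : ℂ) = 2 by norm_num] at h
  rw [← h, ← integral_comp_rpow_Ioi (fun t : ℝ => (t : ℂ) ^ (d / 2 + Complex.I * s - 1 : ℂ) * Complex.exp (-((1 / 2 : ℝ) * t : ℂ))) (p := 2) (by norm_num), ← integral_const_mul]
  refine setIntegral_congr_fun measurableSet_Ioi fun y hy => ?_
  have hy : 0 < y := hy
  have hy' : (y : ℂ) ≠ 0 := by exact_mod_cast hy.ne'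
  simp only [Complex.real_smul]
  rw [Complex.cpow_def_of_ne_zero (by simpa using hy.ne')]
  have e1 : Complex.log ((y ^ (2:ℝ) : ℝ) : ℂ) = (2 * Real.log y : ℝ) := by
    rw [← Complex.ofReal_log (by positivity), Real.log_rpow hy]
  have e2 : Real.log (y ^ 2) = 2 * Real.log y := by simp
  have e3 : (y ^ (d-1) : ℝ) = Real.exp ((d - 1) * Real.log y) := by
    rw [← Real.rpow_natCast, Real.rpow_def_of_pos hy, Nat.cast_sub hd]; push_cast; ring_nf
  rw [e1, e2, e3, gD]
  have e4 : ((|2| * y ^ ((2:ℝ) - 1) : ℝ) : ℂ) = 2 * Complex.exp (Real.log y) := by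
    rw [← Complex.ofReal_exp, Real.exp_log hy]; norm_num
  rw [e4, Real.rpow_two]
  push_cast
  rw [show ∀ a b c : ℂ, 1/2 * (2 * a * (b * c)) = a * b * c by intros; ring]
  rw [← mul_assoc]
  simp only [← Complex.exp_add]
  congr 1
  ring

lemma radial [Nontrivial E] (s : ℝ) :
    ∫ x, Complex.exp (Complex.I * s * Real.log (‖x‖^2)) ∂stdGaussian E
      = RR (Module.finrank ℝ E) s := by
  have hd : 0 < Module.finrank ℝ E := Module.finrank_pos
  have key : ∀ s : ℝ, ∫ x, Complex.exp (Complex.I * s * Real.log (‖x‖^2)) ∂stdGaussian E =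
      (gC E * (Module.finrank ℝ E * (volume : Measure E).real (Metric.ball 0 1)) * (1/2)) * ((2:ℂ) ^ ((Module.finrank ℝ E : ℂ) / 2 + Complex.I * s) * Complex.Gamma (Module.finrank ℝ E / 2 + Complex.I * s)) := by
    intro s
    rw [stdGaussian_integral, integral_fun_norm_addHaar volume (fun y => (gD y : ℂ) * Complex.exp (Complex.I * s * Real.log (y^2))), radial_aux _ hd]
    simp only [nsmul_eq_mul, Complex.real_smul]
    ring
  have h0 := key 0
  simp only [Complex.ofReal_zero, mul_zero, zero_mul, Complex.exp_zero, add_zero] at h0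
  have h00 : ∫ x : E, (1:ℂ) ∂stdGaussian E = 1 := by simp
  rw [h00] at h0
  rw [key, RR]
  set K := (gC E * (Module.finrank ℝ E * (volume : Measure E).real (Metric.ball 0 1)) * (1/2) : ℂ)
  have hG : Complex.Gamma ((Module.finrank ℝ E : ℂ) / 2) ≠ 0 := by
    intro h; rw [h] at h0; simp at h0
  rw [Complex.cpow_add _ _ two_ne_zero, Complex.cpow_def_of_ne_zero two_ne_zero (Complex.I * s)]
  have : Complex.log 2 = (Real.log 2 : ℝ) := by
    rw [Complex.ofReal_log (by norm_num)]; norm_num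
  rw [this]
  rw [mul_comm ((Real.log 2 : ℝ):ℂ) (Complex.I * s)]
  rw [show ∀ a b c d : ℂ, a * (b * c * d) = (a * b) * (c * d) by intros; ring, ← mul_div_assoc, eq_div_iff hG]
  linear_combination (-Complex.exp (Complex.I * s * (Real.log 2 : ℝ)) * Complex.Gamma ((Module.finrank ℝ E : ℂ) / 2 + Complex.I * s)) * h0

end gaussE

open Filter Topology MeasureTheory ProbabilityTheory Matrix

section gramE
variable {E : Type*} [NormedAddCommGroup E] [InnerProductSpace ℝ E] [FiniteDimensional ℝ E]
  [MeasurableSpace E] [BorelSpace E]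

lemma proj_stdGaussian (K : Submodule ℝ E) :
    (stdGaussian E).map (K.orthogonalProjectionOnto : E →L[ℝ] K) = stdGaussian K := by
  have : IsProbabilityMeasure ((stdGaussian E).map (K.orthogonalProjectionOnto : E →L[ℝ] K)) :=
    Measure.isProbabilityMeasure_map (by fun_prop)
  apply Measure.ext_of_charFun
  ext t
  rw [charFun_stdGaussian, charFun_apply, integral_map (by fun_prop)
    (Measurable.aestronglyMeasurable (by fun_prop))]
  simp_rw [Submodule.inner_orthogonalProjectionOnto_eq_of_mem_right]
  rw [← charFun_apply, charFun_stdGaussian]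
  simp

lemma stdGaussian_ae_ne_zero [Nontrivial E] : ∀ᵐ x ∂(stdGaussian E), x ≠ 0 := by
  have h : stdGaussian E ≪ volume := by
    rw [stdGaussian_density]; exact withDensity_absolutelyContinuous _ _
  have h2 : ∀ᵐ x ∂(volume : Measure E), x ≠ 0 := by rw [ae_iff]; simp
  exact h.ae_le h2

lemma gram_det_cons {E : Type*} [NormedAddCommGroup E] [InnerProductSpace ℝ E]
    [FiniteDimensional ℝ E] {q : ℕ} (x : E) (v : Fin q → E) :
    (gram ℝ (Fin.cons x v : Fin (q+1) → E)).det =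
      ‖(Submodule.span ℝ (Set.range v))ᗮ.orthogonalProjectionOnto x‖ ^ 2 * (gram ℝ v).det := by
  set U := Submodule.span ℝ (Set.range v) with hU
  obtain ⟨c, hc⟩ := (Submodule.mem_span_range_iff_exists_fun ℝ).1 (U.starProjection_apply_mem x)
  set w : E := Uᗮ.starProjection x with hw
  have hxw : U.starProjection x + w = x := Submodule.starProjection_add_starProjection_orthogonal x
  have hwv : ∀ j, inner ℝ w (v j) = 0 := fun j =>
    Submodule.inner_left_of_mem_orthogonal (K := U) (Submodule.subset_span (Set.mem_range_self j)) (Uᗮ.starProjection_apply_mem x)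
  have hwU : inner ℝ w (U.starProjection x) = 0 :=
    Submodule.inner_left_of_mem_orthogonal (U.starProjection_apply_mem x) (Uᗮ.starProjection_apply_mem x)
  have hwx : inner ℝ w x = ‖w‖^2 := by
    nth_rw 1 [← hxw]
    rw [inner_add_right, hwU, zero_add, real_inner_self_eq_norm_sq]
  have hn : ‖Uᗮ.orthogonalProjectionOnto x‖ = ‖w‖ := rfl
  rw [hn]
  set f : Fin (q+1) → E := Fin.cons x v
  set d : Fin (q+1) → ℝ := Fin.cons 1 (fun j => - c j)
  have h1 := det_updateRow_sum (gram ℝ f) 0 d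
  have hd0 : d 0 = 1 := rfl
  have hrow : ∀ k, (∑ i, d i • (gram ℝ f) i) k = inner ℝ w (f k) := by
    intro k
    have : w = ∑ i, d i • f i := by
      rw [Fin.sum_univ_succ]
      simp only [d, f, Fin.cons_zero, Fin.cons_succ, one_smul, neg_smul, Finset.sum_neg_distrib, hc]
      exact eq_add_neg_of_add_eq (by rw [add_comm]; exact hxw)
    rw [this, sum_inner]
    simp [Finset.sum_apply, gram_apply, inner_smul_left]
  rw [hd0, one_smul, show (∑ i, d i • (gram ℝ f) i) = fun k => inner ℝ w (f k) from funext hrow] at h1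
  rw [← h1, det_succ_row_zero, Fin.sum_univ_succ]
  simp only [updateRow_self]
  rw [Finset.sum_eq_zero]
  · simp only [Fin.val_zero, pow_zero, one_mul, add_zero]
    have : f 0 = x := rfl
    rw [this, hwx]
    congr 2
  · intro j _
    have : f j.succ = v j := rfl
    rw [this, hwv]; simp

lemma meas_gram_det (q : ℕ) : Measurable (fun v : Fin q → E => (gram ℝ v).det) := by
  apply Continuous.measurable
  apply Continuous.matrix_det
  apply continuous_matrix
  intro i j
  simp only [gram_apply]
  fun_prop

lemma meas_cexp_log {X : Type*} [MeasurableSpace X] {f : X → ℝ} (hf : Measurable f) (s : ℝ) :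
    Measurable (fun x => Complex.exp (Complex.I * s * Real.log (f x))) := by
  have := Real.measurable_log.comp hf
  have h2 : Measurable (fun x => ((Real.log (f x) : ℝ) : ℂ)) := Complex.measurable_ofReal.comp this
  exact Complex.measurable_exp.comp (h2.const_mul _)

lemma norm_cexp_I (s x : ℝ) : ‖Complex.exp (Complex.I * s * x)‖ = 1 := by
  rw [show Complex.I * s * x = ((s * x : ℝ) : ℂ) * Complex.I by push_cast; ring]
  exact Complex.norm_exp_ofReal_mul_I _

lemma gram_law (q : ℕ) (hq : q ≤ Module.finrank ℝ E) :
    (∀ᵐ v ∂(Measure.pi fun _ : Fin q => stdGaussian E), (gram ℝ v).det ≠ 0) ∧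
    ∀ s : ℝ, ∫ v, Complex.exp (Complex.I * s * Real.log (gram ℝ v).det)
        ∂(Measure.pi fun _ : Fin q => stdGaussian E) =
      ∏ i ∈ Finset.range q, RR (Module.finrank ℝ E - i) s := by
  induction q with
  | zero => simp
  | succ q ih =>
    obtain ⟨ih1, ih2⟩ := ih (by omega)
    have mp := measurePreserving_piFinSuccAbove (fun _ : Fin (q+1) => stdGaussian E) 0
    set e := MeasurableEquiv.piFinSuccAbove (fun _ : Fin (q+1) => E) 0
    have mps := mp.symm
    have es : ∀ z : E × (Fin q → E), e.symm z = (Fin.cons z.1 z.2 : Fin (q+1) → E) := by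
      intro z; simp [e]; rfl
    have key : ∀ v : Fin q → E, (gram ℝ v).det ≠ 0 →
        Module.finrank ℝ (Submodule.span ℝ (Set.range v))ᗮ = Module.finrank ℝ E - q := by
      intro v hv
      have h1 := finrank_span_eq_card (det_gram_ne_zero_iff_linearIndependent.1 hv)
      have h2 := Submodule.finrank_add_finrank_orthogonal (Submodule.span ℝ (Set.range v))
      simp at h1
      omega
    have meas : Measurable (fun z : E × (Fin q → E) => (gram ℝ (e.symm z)).det) :=
      (meas_gram_det (q+1)).comp e.symm.measurable
    constructor
    · have hset : MeasurableSet {v : Fin (q+1) → E | (gram ℝ v).det ≠ 0} :=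
        (meas_gram_det (q+1)) (measurableSet_singleton 0).compl
      rw [← mps.map_eq, ae_map_iff mps.aemeasurable hset]
      have hset' : MeasurableSet {z : E × (Fin q → E) | (gram ℝ (e.symm z)).det ≠ 0} :=
        meas (measurableSet_singleton 0).compl
      rw [Measure.ae_prod_iff_ae_ae hset', Measure.ae_ae_comm hset']
      filter_upwards [ih1] with v hv
      have hk := key v hv
      have : Nontrivial (Submodule.span ℝ (Set.range v))ᗮ :=
        Module.nontrivial_of_finrank_pos (R := ℝ) (by omega)
      have h3 := stdGaussian_ae_ne_zero (E := (Submodule.span ℝ (Set.range v))ᗮ)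
      rw [← proj_stdGaussian] at h3
      have h4 := ae_of_ae_map (by fun_prop) h3
      filter_upwards [h4] with x hx
      rw [es, gram_det_cons]
      exact mul_ne_zero (by positivity) hv
    · intro s
      rw [← mps.integral_comp e.symm.measurableEmbedding, integral_prod_symm]
      · rw [Finset.prod_range_succ, ← ih2 s, ← integral_mul_const]
        apply integral_congr_ae
        filter_upwards [ih1] with v hv
        have hk := key v hv
        have : Nontrivial (Submodule.span ℝ (Set.range v))ᗮ :=
          Module.nontrivial_of_finrank_pos (R := ℝ) (by omega)
        rw [← hk, ← radial, ← proj_stdGaussian, integral_map (by fun_prop)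
          (meas_cexp_log (by fun_prop) s).aestronglyMeasurable, ← integral_const_mul]
        apply integral_congr_ae
        have h3 := stdGaussian_ae_ne_zero (E := (Submodule.span ℝ (Set.range v))ᗮ)
        rw [← proj_stdGaussian] at h3
        have h4 := ae_of_ae_map (by fun_prop) h3
        filter_upwards [h4] with x hx
        simp only [es, gram_det_cons]
        rw [Real.log_mul (by positivity) hv, ← Complex.exp_add]
        congr 1
        push_cast
        ring
      · apply Integrable.of_bound (C := 1) (meas_cexp_log meas s).aestronglyMeasurable
        exact .of_forall fun z => (norm_cexp_I _ _).le
end gramE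

noncomputable def colMap (m q : ℕ) (v : Fin q → EuclideanSpace ℝ (Fin m)) : Fin m × Fin q → ℝ :=
  fun ij => v ij.2 ij.1

lemma colMap_meas (m q : ℕ) : Measurable (colMap m q) := by
  unfold colMap
  apply measurable_pi_lambda
  intro ij
  fun_prop

lemma colMap_law (m q : ℕ) :
    (Measure.pi fun _ : Fin q => stdGaussian (EuclideanSpace ℝ (Fin m))).map (colMap m q) =
      Measure.pi fun _ => gaussianReal 0 1 := by
  symm
  apply Measure.pi_eq
  intro s hs
  rw [Measure.map_apply (colMap_meas m q) (MeasurableSet.univ_pi hs)]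
  have h1 : colMap m q ⁻¹' (Set.univ.pi s) =
      Set.univ.pi fun j => {x : EuclideanSpace ℝ (Fin m) | ∀ i, x i ∈ s (i, j)} := by
    ext v
    simp only [Set.mem_preimage, Set.mem_univ_pi, colMap, Set.mem_ofPred_eq, Prod.forall]
    exact forall_comm
  rw [h1, Measure.pi_pi, Fintype.prod_prod_type_right]
  congr 1
  ext j
  have hm : MeasurableSet {x : EuclideanSpace ℝ (Fin m) | ∀ i, x i ∈ s (i, j)} := by
    rw [Set.ofPred_forall]
    apply MeasurableSet.iInter
    intro i
    exact (by fun_prop : Measurable (fun x : EuclideanSpace ℝ (Fin m) => x i)) (hs _)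
  rw [← map_pi_eq_stdGaussian, Measure.map_apply (by fun_prop) hm, ← Measure.pi_pi]
  congr 1
  ext x
  simp

noncomputable def ZZ (m q : ℕ) (ω : Fin m × Fin q → ℝ) : Matrix (Fin q) (Fin q) ℝ :=
  (Matrix.of fun i j => ω (i, j))ᵀ * (Matrix.of fun i j => ω (i, j))

lemma ZZ_colMap (m q : ℕ) (v) : ZZ m q (colMap m q v) = gram ℝ v := by
  ext i j
  simp [ZZ, colMap, Matrix.mul_apply, gram_apply, PiLp.inner_apply, mul_comm]

lemma ZZ_trace (m q : ℕ) (ω) : (ZZ m q ω).trace = ∑ ij, ω ij ^ 2 := by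
  simp [ZZ, Matrix.trace, Matrix.mul_apply, Fintype.sum_prod_type_right, sq]

lemma logS_eq (m q : ℕ) (ω) : logSphericityStat m q ω =
    Real.log ((ZZ m q ω).det * (((ZZ m q ω).trace / q) ^ (-(q : ℤ)))) := rfl

lemma ZZ_det_meas (m q : ℕ) : Measurable (fun ω => (ZZ m q ω).det) := by
  apply Continuous.measurable
  apply Continuous.matrix_det
  apply continuous_matrix
  intro i j
  simp only [ZZ, Matrix.mul_apply, Matrix.transpose_apply, Matrix.of_apply]
  fun_prop

lemma logS_meas (m q : ℕ) : Measurable (logSphericityStat m q) := by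
  have h : Measurable fun ω : Fin m × Fin q → ℝ =>
      Real.log ((ZZ m q ω).det * (((∑ ij, ω ij ^ 2) / q) ^ (-(q : ℤ)))) := by
    apply Real.measurable_log.comp
    apply (ZZ_det_meas m q).mul
    simp only [_root_.zpow_neg, zpow_natCast]
    fun_prop
  convert h using 2 with ω
  rw [logS_eq, ZZ_trace]

lemma logS_smul (m q : ℕ) (r : ℝ) (hr : 0 < r) (ω : Fin m × Fin q → ℝ) :
    logSphericityStat m q (r • ω) = logSphericityStat m q ω := by
  rw [logS_eq, logS_eq]
  have : ZZ m q (r • ω) = (r^2) • ZZ m q ω := by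
    ext i j
    simp [ZZ, Matrix.mul_apply, Finset.mul_sum]
    congr 1; ext k; ring
  rw [this, Matrix.det_smul, Matrix.trace_smul, smul_eq_mul, mul_div_assoc, mul_zpow]
  congr 1
  have : (r^2)^(q:ℕ) * (r^2)^(-(q:ℤ)) = 1 := by
    rw [_root_.zpow_neg, zpow_natCast, mul_inv_cancel₀ (by positivity)]
  simp only [Fintype.card_fin]
  linear_combination ((ZZ m q ω).det * ((ZZ m q ω).trace / q) ^ (-(q:ℤ))) * this

lemma main_identity (m q : ℕ) (hq : 0 < q) (hqm : q ≤ m) (s : ℝ) :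
    (∫ ω, Complex.exp (Complex.I * s * logSphericityStat m q ω)
      ∂(Measure.pi fun _ : Fin m × Fin q => gaussianReal 0 1)) *
      (Complex.exp (-(Complex.I * s * q * Real.log q)) * RR (m * q) (s * q)) =
    ∏ i ∈ Finset.range q, RR (m - i) s := by
  have hm : 0 < m := by omega
  have : Nonempty (Fin m × Fin q) := ⟨(⟨0, hm⟩, ⟨0, hq⟩)⟩
  have hN : Nontrivial (EuclideanSpace ℝ (Fin m × Fin q)) := by
    apply Module.nontrivial_of_finrank_pos (R := ℝ)
    simp; exact ⟨hm, hq⟩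
  have hG := gram_law (E := EuclideanSpace ℝ (Fin m)) q (by simpa using hqm)
  simp only [finrank_euclideanSpace_fin] at hG
  have hae : ∀ᵐ ω ∂(Measure.pi fun _ : Fin m × Fin q => gaussianReal 0 1), (ZZ m q ω).det ≠ 0 := by
    rw [← colMap_law, ae_map_iff (colMap_meas m q).aemeasurable
      (show MeasurableSet {ω | (ZZ m q ω).det ≠ 0} from
        (ZZ_det_meas m q) (measurableSet_singleton 0).compl)]
    simpa only [ZZ_colMap] using hG.1
  have hdet := hG.2 s
  have hdet' : ∫ ω, Complex.exp (Complex.I * s * Real.log (ZZ m q ω).det)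
      ∂(Measure.pi fun _ : Fin m × Fin q => gaussianReal 0 1) = ∏ i ∈ Finset.range q, RR (m - i) s := by
    rw [← hdet, ← colMap_law, integral_map (colMap_meas m q).aemeasurable
      (meas_cexp_log (ZZ_det_meas m q) s).aestronglyMeasurable]
    simp only [ZZ_colMap]
  set h : ℝ → ℂ := fun ρ => Complex.exp (-(Complex.I * s * q * Real.log q)) *
    Complex.exp (Complex.I * (s * q : ℝ) * Real.log (ρ^2)) with hh
  set g : (EuclideanSpace ℝ (Fin m × Fin q)) → ℂ := fun x => Complex.exp (Complex.I * s * logSphericityStat m q (WithLp.ofLp x)) with hg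
  have hb := basu g (fun r x hr => by simp only [hg, WithLp.ofLp_smul, logS_smul m q r hr]) h
  have h2 : ∫ x, h ‖x‖ ∂stdGaussian (EuclideanSpace ℝ (Fin m × Fin q)) =
      Complex.exp (-(Complex.I * s * q * Real.log q)) * RR (m * q) (s * q) := by
    simp only [hh]
    rw [integral_const_mul, radial]
    simp
  have hgm : Measurable g := by
    have := (logS_meas m q).comp (by fun_prop : Measurable (fun x : (EuclideanSpace ℝ (Fin m × Fin q)) => WithLp.ofLp x))
    have h2 : Measurable (fun x : (EuclideanSpace ℝ (Fin m × Fin q)) => ((logSphericityStat m q (WithLp.ofLp x) : ℝ) : ℂ)) :=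
      Complex.measurable_ofReal.comp this
    exact Complex.measurable_exp.comp (h2.const_mul _)
  have hhm : Measurable (fun x : (EuclideanSpace ℝ (Fin m × Fin q)) => h ‖x‖) :=
    (meas_cexp_log (by fun_prop) _).const_mul _
  have h3 : ∫ x, g x ∂stdGaussian (EuclideanSpace ℝ (Fin m × Fin q)) = ∫ ω, Complex.exp (Complex.I * s * logSphericityStat m q ω)
      ∂(Measure.pi fun _ : Fin m × Fin q => gaussianReal 0 1) := by
    rw [← map_pi_eq_stdGaussian, integral_map (by fun_prop) hgm.aestronglyMeasurable]
  have h4 : ∫ x, h ‖x‖ * g x ∂stdGaussian (EuclideanSpace ℝ (Fin m × Fin q)) = ∏ i ∈ Finset.range q, RR (m - i) s := by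
    rw [← map_pi_eq_stdGaussian, integral_map (by fun_prop) (show Measurable fun x => h ‖x‖ * g x from hhm.mul hgm).aestronglyMeasurable,
      ← hdet']
    apply integral_congr_ae
    filter_upwards [hae] with ω hω
    have hn : ‖(WithLp.toLp 2 ω : (EuclideanSpace ℝ (Fin m × Fin q)))‖^2 = (ZZ m q ω).trace := by
      rw [ZZ_trace, EuclideanSpace.norm_sq_eq]; simp
    have ht : (ZZ m q ω).trace ≠ 0 := by
      intro h0
      rw [ZZ_trace, Finset.sum_eq_zero_iff_of_nonneg (fun _ _ => sq_nonneg _)] at h0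
      have : ω = 0 := by ext i; simpa using h0 i (Finset.mem_univ _)
      apply hω
      subst this
      have : ZZ m q 0 = 0 := by ext i j; simp [ZZ, Matrix.mul_apply]
      have hne : Nonempty (Fin q) := ⟨⟨0, hq⟩⟩
      rw [this, Matrix.det_zero]
    have hq' : (q : ℝ) ≠ 0 := by exact_mod_cast hq.ne'
    simp only [hh, hg]
    rw [hn, logS_eq, Real.log_mul hω (zpow_ne_zero _ (div_ne_zero ht hq')), Real.log_zpow,
      Real.log_div ht hq', ← Complex.exp_add, ← Complex.exp_add]
    congr 1
    push_cast
    ring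
  rw [h2, h3, h4] at hb
  rw [hb, mul_comm]

lemma clog_taylor (z : ℂ) (hz : 0 ≤ z.re) :
    ‖Complex.log (1 + z) - z + z ^ 2 / 2‖ ≤ ‖z‖ ^ 3 := by
  have hre : ∀ t : ℝ, 0 ≤ t → 1 ≤ (1 + t * z).re := by
    intro t ht
    simp; positivity
  have hd : ∀ t ∈ Set.Icc (0:ℝ) 1, HasDerivWithinAt
      (fun t : ℝ => Complex.log (1 + t * z) - t * z + (t * z) ^ 2 / 2)
      (z * (t * z)^2 / (1 + t * z)) (Set.Icc 0 1) t := by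
    intro t ht
    have h1 := hre t ht.1
    have hne : (1 + t * z : ℂ) ≠ 0 := by
      intro h; rw [h] at h1; simp at h1; linarith
    have hl : HasDerivAt (fun t : ℝ => (t : ℂ) * z) z t := by
      simpa using (Complex.ofRealCLM.hasDerivAt (x := t)).mul_const z
    have hl2 : HasDerivAt (fun t : ℝ => 1 + (t : ℂ) * z) z t := by
      simpa using hl.const_add 1
    have hlog := hl2.clog_real (x := t) (Or.inl (by linarith))
    have := (hlog.sub hl).add ((hl.pow 2).div_const 2)
    refine (this.congr_deriv ?_).hasDerivWithinAt
    have hdm : z / (1 + t * z) * (1 + t * z) = z := div_mul_cancel₀ _ hne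
    rw [eq_div_iff hne]
    push_cast
    simp only [pow_one]
    linear_combination hdm
  have := norm_image_sub_le_of_norm_deriv_le_segment_01' hd (C := ‖z‖^3) (by
    intro t ht
    have h1 := hre t ht.1
    have h2 : 1 ≤ ‖(1 + t * z : ℂ)‖ := h1.trans (Complex.re_le_norm _)
    rw [norm_div, div_le_iff₀ (by linarith)]
    have : ‖z * (t * z)^2‖ = t^2 * ‖z‖^3 := by
      simp only [norm_mul, norm_pow, Complex.norm_real, Real.norm_eq_abs, abs_of_nonneg ht.1]; ring
    rw [this]
    have ht2 : t^2 ≤ 1 := by have := ht.1; have := ht.2; nlinarith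
    have h3 : 0 ≤ ‖z‖^3 := by positivity
    nlinarith)
  simpa using this

lemma rlog_taylor (t : ℝ) (ht : 0 ≤ t) : |Real.log (1 + t) - t + t ^ 2 / 2| ≤ t ^ 3 := by
  have := clog_taylor (t : ℂ) (by simpa using ht)
  rw [show Complex.log (1 + (t:ℂ)) = ((Real.log (1 + t) : ℝ) : ℂ) by
    rw [Complex.ofReal_log (by linarith)]; push_cast; rfl] at this
  rw [show ((Real.log (1 + t) : ℝ) : ℂ) - t + (t:ℂ) ^ 2 / 2 =
    ((Real.log (1 + t) - t + t ^ 2 / 2 : ℝ) : ℂ) by push_cast; rfl] at this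
  rw [Complex.norm_real, Complex.norm_real, Real.norm_eq_abs, Real.norm_eq_abs, abs_of_nonneg ht] at this
  exact this

lemma log_succ_taylor (x : ℝ) (hx : 0 < x) :
    |Real.log (x + 1) - Real.log x - 1 / x + 1 / (2 * x ^ 2)| ≤ 1 / x ^ 3 := by
  have := rlog_taylor (1 / x) (by positivity)
  rw [show 1 + 1 / x = (x + 1) / x by field_simp, Real.log_div (by positivity) (by positivity)] at this
  convert this using 1
  · congr 1; field_simp
  · field_simp

noncomputable def LL (s x : ℝ) : ℂ :=
  Complex.I * s * ((Real.log x - 1 / (2 * x) : ℝ) : ℂ) - ((s ^ 2 / (2 * x) : ℝ) : ℂ)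

noncomputable def gg (s x : ℝ) : ℂ :=
  Complex.log (1 + Complex.I * s / x) - (LL s (x + 1) - LL s x)

lemma gg_bound (s x : ℝ) (hx : 0 < x) : ‖gg s x‖ ≤ (2 * |s| + s^2 + |s|^3) * (1 / x^3) := by
  have e : gg s x = (Complex.log (1 + Complex.I * s / x) - Complex.I * s / x + (Complex.I * s / x)^2/2)
    + (Complex.I * s) * ((-(Real.log (x+1) - Real.log x - 1/x + 1/(2*x^2)) + 1/(2*x^2*(x+1)) : ℝ) : ℂ)
    + ((s^2 * (1/(2 * x^2 * (x+1))) : ℝ) : ℂ) := by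
    unfold gg LL
    have hx' : (x:ℂ) ≠ 0 := by exact_mod_cast hx.ne'
    have hx1 : (x:ℂ) + 1 ≠ 0 := by exact_mod_cast (by linarith : x + 1 ≠ 0)
    push_cast
    field_simp
    rw [Complex.I_sq]
    ring
  have h1 := clog_taylor (Complex.I * s / x) (by simp)
  have n1 : ‖Complex.I * s / x‖ = |s| / x := by
    simp [abs_of_pos hx]
  rw [n1] at h1
  have h2 := log_succ_taylor x hx
  have h3 : 1/(2*x^2*(x+1)) ≤ 1 / x^3 := by
    apply one_div_le_one_div_of_le (by positivity)
    nlinarith [pow_pos hx 3, pow_pos hx 2]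
  have h30 : 0 ≤ 1/(2*x^2*(x+1)) := by positivity
  rw [e]
  refine (norm_add_le _ _).trans ?_
  refine (add_le_add_left (norm_add_le _ _) _).trans ?_
  rw [norm_mul, Complex.norm_real, Complex.norm_real, Real.norm_eq_abs, Real.norm_eq_abs]
  have n2 : ‖Complex.I * (s:ℂ)‖ = |s| := by simp
  rw [n2]
  have h4 : |-(Real.log (x+1) - Real.log x - 1/x + 1/(2*x^2)) + 1/(2*x^2*(x+1))| ≤ 2 * (1 / x^3) := by
    refine (abs_add_le _ _).trans ?_
    rw [abs_neg, abs_of_nonneg h30]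
    linarith
  have h5 : |s^2 * (1/(2 * x^2 * (x+1)))| ≤ s^2 * (1/x^3) := by
    rw [abs_of_nonneg (by positivity)]
    exact mul_le_mul_of_nonneg_left h3 (sq_nonneg s)
  have h6 := mul_le_mul_of_nonneg_left h4 (abs_nonneg s)
  have h7 : (|s|/x)^3 = |s|^3 * (1/x^3) := by field_simp
  rw [h7] at h1
  linarith

lemma sum_cube (x : ℝ) (hx : 1 ≤ x) (N : ℕ) :
    ∑ j ∈ Finset.range N, 1 / (x + j)^3 ≤ 2 / x^2 - 2 / (x + N)^2 := by
  induction N with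
  | zero => simp
  | succ N ih =>
    rw [Finset.sum_range_succ]
    have hy : 1 ≤ x + N := by have : (0:ℝ) ≤ N := N.cast_nonneg; linarith
    push_cast
    rw [← add_assoc x]
    set y := x + (N:ℝ)
    have : 1 / y^3 ≤ 2 / y^2 - 2 / (y+1)^2 := by
      rw [div_sub_div _ _ (by positivity) (by positivity), div_le_div_iff₀ (by positivity) (by positivity)]
      nlinarith [pow_pos (by linarith : 0 < y) 2, pow_pos (by linarith : 0 < y) 3, pow_pos (by linarith : 0 < y) 4]
    linarith

lemma gamma_ratio (x : ℝ) (hx : 1 ≤ x) (s : ℝ) :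
    ∃ ε : ℂ, ‖ε‖ ≤ (2 * |s| + s^2 + |s|^3) * (2 / x^2) ∧
      Complex.Gamma (x + Complex.I * s) / Complex.Gamma x = Complex.exp (LL s x + ε) := by
  set K := 2 * |s| + s^2 + |s|^3 with hK
  have hK0 : 0 ≤ K := by positivity
  have hpos : ∀ j : ℕ, 0 < x + j := fun j => by have : (0:ℝ) ≤ j := j.cast_nonneg; linarith
  have hpart : ∀ N, ∑ j ∈ Finset.range N, ‖gg s (x + j)‖ ≤ K * (2 / x^2) := by
    intro N
    calc _ ≤ ∑ j ∈ Finset.range N, K * (1 / (x + j)^3) :=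
          Finset.sum_le_sum fun j _ => gg_bound s _ (hpos j)
      _ = K * ∑ j ∈ Finset.range N, 1 / (x + j)^3 := by rw [Finset.mul_sum]
      _ ≤ _ := by
        apply mul_le_mul_of_nonneg_left _ hK0
        have := sum_cube x hx N
        have : 0 ≤ 2 / (x + N)^2 := by positivity
        linarith
  have hsn : Summable (fun j : ℕ => ‖gg s (x + j)‖) :=
    summable_of_sum_range_le (fun _ => norm_nonneg _) hpart
  have hs := hsn.of_norm
  refine ⟨-∑' j : ℕ, gg s (x + j), ?_, ?_⟩
  · rw [norm_neg]
    exact (norm_tsum_le_tsum_norm hsn).trans (Real.tsum_le_of_sum_range_le (fun _ => norm_nonneg _) hpart)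
  set z : ℂ := x + Complex.I * s with hz
  have hzre : z.re = x := by simp [z]
  have hΓz : Complex.Gamma z ≠ 0 := Complex.Gamma_ne_zero_of_re_pos (by rw [hzre]; linarith)
  have hΓx : Complex.Gamma x ≠ 0 := Complex.Gamma_ne_zero_of_re_pos (by simp; linarith)
  have hzj : ∀ j : ℕ, z + j ≠ 0 := by
    intro j h
    have := congrArg Complex.re h
    simp [hzre] at this
    have := hpos j; linarith
  have hxj : ∀ j : ℕ, (x:ℂ) + j ≠ 0 := by
    intro j
    exact_mod_cast (hpos j).ne'
  have hprod : ∀ N : ℕ, (∏ j ∈ Finset.range N, (z + j)) / (∏ j ∈ Finset.range N, ((x:ℂ) + j)) =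
      Complex.exp (LL s (x + N) - LL s x + ∑ j ∈ Finset.range N, gg s (x + j)) := by
    intro N
    induction N with
    | zero => simp
    | succ N ih =>
      rw [Finset.prod_range_succ, Finset.prod_range_succ, Finset.sum_range_succ, mul_div_mul_comm, ih]
      have : (z + N) / ((x:ℂ) + N) = Complex.exp (LL s (x + N + 1) - LL s (x + N) + gg s (x + N)) := by
        unfold gg
        rw [show ∀ a b c : ℂ, a - b + (c - (a - b)) = c by intros; ring, Complex.exp_log]
        · push_cast
          rw [eq_comm, eq_div_iff (hxj N), add_mul, one_mul, div_mul_cancel₀ _ (hxj N), hz]; ring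
        · push_cast
          intro h
          apply hzj N
          have := congrArg (· * ((x:ℂ) + N)) h
          simp only [add_mul, one_mul, div_mul_cancel₀ _ (hxj N), zero_mul] at this
          rw [← this, hz]; ring
      rw [this, ← Complex.exp_add]
      congr 1
      push_cast
      rw [← add_assoc x]
      ring
  have hseq : ∀ N : ℕ, N ≠ 0 → Complex.GammaSeq x N / Complex.GammaSeq z N =
      Complex.exp (-(Complex.I * s * Real.log N)) * ((∏ j ∈ Finset.range (N+1), (z + j)) / (∏ j ∈ Finset.range (N+1), ((x:ℂ) + j))) := by
    intro N hN
    have hN' : (N:ℂ) ≠ 0 := by exact_mod_cast hN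
    unfold Complex.GammaSeq
    have h1 : (N:ℂ)^z = (N:ℂ)^(x:ℂ) * Complex.exp (Complex.I * s * Real.log N) := by
      rw [hz, Complex.cpow_add _ _ hN', Complex.cpow_def_of_ne_zero hN' (Complex.I * s)]
      rw [show (N:ℂ) = ((N:ℝ):ℂ) by simp, ← Complex.ofReal_log (by positivity)]
      ring_nf
    have h2 : (N:ℂ)^(x:ℂ) ≠ 0 := by
      rw [Complex.cpow_def_of_ne_zero hN']; exact Complex.exp_ne_zero _
    have h3 : (∏ j ∈ Finset.range (N+1), ((x:ℂ) + j)) ≠ 0 := Finset.prod_ne_zero_iff.2 fun j _ => hxj j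
    have h4 : (∏ j ∈ Finset.range (N+1), (z + j)) ≠ 0 := Finset.prod_ne_zero_iff.2 fun j _ => hzj j
    have h5 : (N.factorial : ℂ) ≠ 0 := by exact_mod_cast N.factorial_ne_zero
    have h6 := Complex.exp_ne_zero (Complex.I * s * Real.log N)
    rw [h1, Complex.exp_neg]
    field_simp
  have hlim1 := ((Complex.GammaSeq_tendsto_Gamma x).div (Complex.GammaSeq_tendsto_Gamma z) hΓz)
  have hlim2 : Tendsto (fun N : ℕ => Complex.exp ((LL s (x + (N+1 : ℕ)) - Complex.I * s * Real.log N)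
      - LL s x + ∑ j ∈ Finset.range (N+1), gg s (x + j))) atTop
      (𝓝 (Complex.exp (0 - LL s x + ∑' j : ℕ, gg s (x + j)))) := by
    apply (Complex.continuous_exp.tendsto _).comp
    refine Tendsto.add (Tendsto.sub_const ?_ _) ((tendsto_add_atTop_iff_nat 1).2 hs.hasSum.tendsto_sum_nat)
    have hA : Tendsto (fun N : ℕ => x + ((N+1 : ℕ) : ℝ)) atTop atTop :=
      tendsto_atTop_add_const_left _ _ ((tendsto_add_atTop_iff_nat 1).2 tendsto_natCast_atTop_atTop)
    have hB : Tendsto (fun N : ℕ => Real.log (x + ((N+1 : ℕ) : ℝ)) - Real.log N) atTop (𝓝 0) := by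
      have h1 : Tendsto (fun N : ℕ => 1 + (x + 1) / (N:ℝ)) atTop (𝓝 (1 + 0)) :=
        (tendsto_const_div_atTop_nhds_zero_nat (x+1)).const_add 1
      have h2 := ((Real.continuousAt_log (by norm_num : (1 + 0 : ℝ) ≠ 0)).tendsto).comp h1
      simp only [add_zero, Real.log_one] at h2
      refine h2.congr' ?_
      filter_upwards [eventually_gt_atTop 0] with N hN
      have hN' : (0:ℝ) < N := by exact_mod_cast hN
      rw [← Real.log_div (by positivity) (by positivity)]
      simp only [Function.comp]
      congr 1
      push_cast
      field_simp
      ring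
    have hC : Tendsto (fun N : ℕ => 1 / (2 * (x + ((N+1 : ℕ) : ℝ)))) atTop (𝓝 0) := by
      simp only [one_div]
      exact tendsto_inv_atTop_zero.comp (hA.const_mul_atTop (by norm_num))
    have hD := hB.sub hC
    have hE : Tendsto (fun N : ℕ => Complex.I * s * ((Real.log (x + ((N+1 : ℕ) : ℝ)) - Real.log N - 1 / (2 * (x + ((N+1 : ℕ) : ℝ))) : ℝ) : ℂ) - ((s^2 * (1 / (2 * (x + ((N+1 : ℕ) : ℝ)))) : ℝ) : ℂ)) atTop (𝓝 (Complex.I * s * ((0 - 0 : ℝ) : ℂ) - ((s^2 * 0 : ℝ) : ℂ))) := by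
      refine Tendsto.sub (Tendsto.const_mul _ ?_) ?_
      · exact (Complex.continuous_ofReal.tendsto _).comp hD
      · exact (Complex.continuous_ofReal.tendsto _).comp (hC.const_mul _)
    simp only [sub_zero, mul_zero, Complex.ofReal_zero] at hE
    refine hE.congr fun N => ?_
    unfold LL
    push_cast
    ring
  have hEq := tendsto_nhds_unique_of_eventuallyEq hlim1 hlim2 (by
    filter_upwards [eventually_ne_atTop 0] with N hN
    simp only [Pi.div_apply]
    rw [hseq N hN, hprod, ← Complex.exp_add]
    congr 1
    ring)
  rw [← inv_div, hEq, ← Complex.exp_neg]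
  congr 1
  ring

noncomputable def KK (s : ℝ) : ℝ := 2 * |s| + s^2 + |s|^3

lemma KK_nonneg (s : ℝ) : 0 ≤ KK s := by unfold KK; positivity

lemma RR_exp (k : ℕ) (hk : 2 ≤ k) (s : ℝ) : ∃ ε : ℂ, ‖ε‖ ≤ KK s * (8 / (k:ℝ)^2) ∧
    RR k s = Complex.exp (Complex.I * s * ((Real.log k - 1 / k : ℝ) : ℂ) - ((s^2 / k : ℝ) : ℂ) + ε) := by
  have hk' : (2:ℝ) ≤ k := by exact_mod_cast hk
  have hk0 : (k:ℂ) ≠ 0 := by exact_mod_cast (by omega : k ≠ 0)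
  obtain ⟨ε, h1, h2⟩ := gamma_ratio ((k:ℝ)/2) (by linarith) s
  refine ⟨ε, ?_, ?_⟩
  · have e : 2 / ((k:ℝ)/2)^2 = 8 / (k:ℝ)^2 := by
      field_simp
      norm_num
    rw [e] at h1
    exact h1
  · unfold RR
    push_cast at h2
    rw [h2, ← Complex.exp_add]
    congr 1
    unfold LL
    rw [Real.log_div (by linarith) (by norm_num)]
    push_cast
    field_simp
    ring

noncomputable def GG (x : ℝ) : ℝ := (x - 1/2) * Real.log x - x

lemma GG_step (j : ℝ) (hj : 1 ≤ j) :
    |Real.log (j+1) - 1/(j+1) - (GG (j+1) - GG j)| ≤ 3 / j^2 ∧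
    |1/(j+1) - (Real.log (j+1) - Real.log j)| ≤ 3 / j^2 := by
  have hj0 : 0 < j := by linarith
  have h := log_succ_taylor j hj0
  set δ := Real.log (j+1) - Real.log j - 1/j + 1/(2*j^2) with hδ
  have hL : Real.log (j+1) = Real.log j + 1/j - 1/(2*j^2) + δ := by rw [hδ]; ring
  have a1 : 1/j - 1/(j+1) ≤ 1/j^2 := by
    rw [div_sub_div _ _ (by positivity) (by positivity), div_le_div_iff₀ (by positivity) (by positivity)]
    nlinarith
  have a2 : 0 ≤ 1/j - 1/(j+1) := by
    have : 1/(j+1) ≤ 1/j := one_div_le_one_div_of_le hj0 (by linarith)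
    linarith
  have a3 : 1/j^3 ≤ 1/j^2 := one_div_le_one_div_of_le (by positivity) (by nlinarith [pow_pos hj0 2])
  have a4 : 0 < 1/j^2 := by positivity
  have a5 : 3 / j^2 = 3 * (1/j^2) := by ring
  have a6 : 1/(2*j^2) = (1/2)*(1/j^2) := by field_simp
  rw [a5]
  constructor
  · have e : Real.log (j+1) - 1/(j+1) - (GG (j+1) - GG j) = (1/j - 1/(j+1)) - (1/4)*(1/j^2) - (j-1/2)*δ := by
      unfold GG
      rw [hL]
      field_simp
      ring
    rw [e]
    have b : |(j-1/2)*δ| ≤ 1/j^2 := by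
      rw [abs_mul, abs_of_nonneg (by linarith)]
      calc _ ≤ j * (1/j^3) := mul_le_mul (by linarith) h (abs_nonneg _) hj0.le
        _ = _ := by field_simp
    have := abs_le.1 b
    rw [abs_le]; constructor <;> linarith
  · have e : 1/(j+1) - (Real.log (j+1) - Real.log j) = -(1/j - 1/(j+1)) + 1/(2*j^2) - δ := by
      rw [hL]; ring
    rw [e, a6]
    have := abs_le.1 h
    rw [abs_le]; constructor <;> linarith

lemma RR_step (j : ℕ) (hj : 1 ≤ j) (s : ℝ) : ∃ ε : ℂ, ‖ε‖ ≤ KK s * (11 / (j:ℝ)^2) ∧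
    RR (j+1) s = Complex.exp (Complex.I * s * ((GG (j+1) - GG j : ℝ) : ℂ)
      - ((s^2 * (Real.log (j+1) - Real.log j) : ℝ) : ℂ) + ε) := by
  obtain ⟨ε, h1, h2⟩ := RR_exp (j+1) (by omega) s
  have hj' : (1:ℝ) ≤ j := by exact_mod_cast hj
  obtain ⟨g1, g2⟩ := GG_step j hj'
  push_cast at h1
  refine ⟨Complex.I * s * ((Real.log (j+1) - 1/(j+1) - (GG (j+1) - GG j) : ℝ) : ℂ)
    - ((s^2 * (1/(j+1) - (Real.log (j+1) - Real.log j)) : ℝ) : ℂ) + ε, ?_, ?_⟩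
  · refine (norm_add_le _ _).trans ?_
    refine (add_le_add_left (norm_sub_le _ _) _).trans ?_
    rw [norm_mul, Complex.norm_real, Complex.norm_real, Real.norm_eq_abs, Real.norm_eq_abs, abs_mul]
    have n2 : ‖Complex.I * (s:ℂ)‖ = |s| := by simp
    rw [n2, abs_of_nonneg (sq_nonneg s)]
    have c1 := mul_le_mul_of_nonneg_left g1 (abs_nonneg s)
    have c2 := mul_le_mul_of_nonneg_left g2 (sq_nonneg s)
    have c3 : 8 / ((j:ℝ)+1)^2 ≤ 8 / (j:ℝ)^2 := by
      apply div_le_div_of_nonneg_left (by norm_num) (by positivity)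
      nlinarith
    have c4 := mul_le_mul_of_nonneg_left c3 (KK_nonneg s)
    have c5 : (|s| + s^2) * (3 / (j:ℝ)^2) ≤ KK s * (3 / (j:ℝ)^2) := by
      apply mul_le_mul_of_nonneg_right _ (by positivity)
      unfold KK
      have : 0 ≤ |s| := abs_nonneg s
      have : 0 ≤ |s|^3 := by positivity
      linarith
    have c6 : KK s * (11 / (j:ℝ)^2) = KK s * (3 / (j:ℝ)^2) + KK s * (8 / (j:ℝ)^2) := by ring
    rw [c6]
    linarith
  · rw [h2]
    congr 1
    push_cast
    ring

lemma RR_prod (m : ℕ) (s : ℝ) (q : ℕ) (hqm : q < m) : ∃ ε : ℂ,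
    ‖ε‖ ≤ KK s * (22 / ((m:ℝ) - q) - 22 / m) ∧
    ∏ i ∈ Finset.range q, RR (m - i) s = Complex.exp (Complex.I * s * ((GG m - GG (m - q) : ℝ) : ℂ)
      - ((s^2 * (Real.log m - Real.log (m - q)) : ℝ) : ℂ) + ε) := by
  induction q with
  | zero => exact ⟨0, by simp, by simp⟩
  | succ q ih =>
    obtain ⟨ε, h1, h2⟩ := ih (by omega)
    obtain ⟨j, rfl⟩ : ∃ j, m = q + 1 + j := ⟨m - (q+1), by omega⟩
    have hj : 1 ≤ j := by omega
    have hj' : (1:ℝ) ≤ j := by exact_mod_cast hj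
    obtain ⟨ε', h3, h4⟩ := RR_step j hj s
    refine ⟨ε + ε', ?_, ?_⟩
    · refine (norm_add_le _ _).trans ((add_le_add h1 h3).trans ?_)
      rw [← mul_add]
      apply mul_le_mul_of_nonneg_left _ (KK_nonneg s)
      push_cast
      rw [show (q:ℝ) + 1 + j - (q + 1) = j by ring, show (q:ℝ) + 1 + j - q = j + 1 by ring]
      have : 11 / (j:ℝ)^2 ≤ 22 / j - 22 / (j+1) := by
        rw [div_sub_div _ _ (by positivity) (by positivity), div_le_div_iff₀ (by positivity) (by positivity)]
        nlinarith [sq_nonneg (j:ℝ)]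
      linarith
    · rw [Finset.prod_range_succ, h2, show q + 1 + j - q = j + 1 by omega, h4, ← Complex.exp_add]
      congr 1
      rw [Nat.cast_add, Nat.cast_add, Nat.cast_one]
      rw [show (q:ℝ) + 1 + j - (q + 1) = j by ring, show (q:ℝ) + 1 + j - q = j + 1 by ring]
      generalize Real.log (j:ℝ) = lj
      push_cast
      ring

lemma KK_mul (s : ℝ) (q : ℕ) (hq : 0 < q) : KK (s * q) ≤ KK s * q^3 := by
  have hq' : (1:ℝ) ≤ q := by exact_mod_cast hq
  unfold KK
  rw [abs_mul, Nat.abs_cast]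
  have h2 : (q:ℝ) ≤ q^3 := by nlinarith [sq_nonneg (q:ℝ)]
  have h3 : (q:ℝ)^2 ≤ q^3 := by nlinarith [sq_nonneg (q:ℝ)]
  have c1 := mul_le_mul_of_nonneg_left h2 (abs_nonneg s)
  have c2 := mul_le_mul_of_nonneg_left h3 (sq_nonneg s)
  rw [mul_pow, mul_pow]
  linarith

lemma char_exp (m q : ℕ) (hq : 0 < q) (hqm : q < m) (s : ℝ) : ∃ E : ℂ,
    ‖E‖ ≤ 31 * KK s / ((m:ℝ) - q) ∧
    (∫ ω, Complex.exp (Complex.I * s * logSphericityStat m q ω) ∂(Measure.pi fun _ : Fin m × Fin q => gaussianReal 0 1)) =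
    Complex.exp (Complex.I * s * ((-(q:ℝ) - ((m:ℝ) - q - 1/2) * Real.log (1 - q / m) : ℝ) : ℂ)
      - ((s^2 * (-Real.log (1 - q / m) - q / m) : ℝ) : ℂ) + E) := by
  have hmain := main_identity m q hq hqm.le s
  obtain ⟨ε, h1, h2⟩ := RR_prod m s q hqm
  obtain ⟨ε', h3, h4⟩ := RR_exp (m*q) (by nlinarith) (s * q)
  have hq' : (1:ℝ) ≤ q := by exact_mod_cast hq
  have hm' : (q:ℝ) + 1 ≤ m := by exact_mod_cast hqm
  have hm0 : (0:ℝ) < m := by linarith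
  have hd : (1:ℝ) ≤ m - q := by linarith
  have hlog : Real.log (1 - q / m) = Real.log (m - q) - Real.log m := by
    rw [← Real.log_div (by linarith) hm0.ne']
    congr 1; field_simp
  refine ⟨ε - ε' + Complex.I * s * ((1 / m : ℝ) : ℂ), ?_, ?_⟩
  · refine (norm_add_le _ _).trans ?_
    refine (add_le_add_left (norm_sub_le _ _) _).trans ?_
    rw [norm_mul, Complex.norm_real, Real.norm_eq_abs]
    have n2 : ‖Complex.I * (s:ℂ)‖ = |s| := by simp
    rw [n2, abs_of_nonneg (one_div_nonneg.2 hm0.le)]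
    have hK := KK_nonneg s
    have i1 : 1 / (m:ℝ) ≤ 1 / (m - q) := one_div_le_one_div_of_le (by linarith) (by linarith)
    have b1 : ‖ε‖ ≤ KK s * (22 * (1 / ((m:ℝ) - q))) := h1.trans (by
      apply mul_le_mul_of_nonneg_left _ hK
      have : 0 ≤ 22 / (m:ℝ) := by positivity
      rw [show 22 * (1 / ((m:ℝ) - q)) = 22 / ((m:ℝ) - q) by ring]
      linarith)
    have b2 : ‖ε'‖ ≤ KK s * (8 * (1 / ((m:ℝ) - q))) := by
      refine h3.trans ?_
      refine (mul_le_mul_of_nonneg_right (KK_mul s q hq) (by positivity)).trans ?_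
      rw [mul_assoc]
      apply mul_le_mul_of_nonneg_left _ hK
      refine le_trans ?_ (mul_le_mul_of_nonneg_left i1 (by norm_num))
      push_cast
      rw [show (q:ℝ)^3 * (8 / ((m:ℝ) * q)^2) = 8 * q / m^2 by field_simp, mul_one_div,
        div_le_div_iff₀ (by positivity) hm0]
      nlinarith
    have b3 : |s| * (1 / (m:ℝ)) ≤ KK s * (1 / ((m:ℝ) - q)) := by
      apply mul_le_mul _ i1 (by positivity) hK
      unfold KK
      have : 0 ≤ |s| := abs_nonneg s
      have : 0 ≤ |s|^3 := by positivity
      nlinarith [sq_nonneg s]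
    rw [show 31 * KK s / ((m:ℝ) - q) = 31 * (KK s * (1 / ((m:ℝ) - q))) by ring]
    linarith
  · rw [h2, h4, ← Complex.exp_add] at hmain
    rw [eq_div_of_mul_eq (Complex.exp_ne_zero _) hmain, ← Complex.exp_sub]
    congr 1
    rw [hlog]
    unfold GG
    rw [Nat.cast_mul, Real.log_mul (by positivity) (by positivity)]
    generalize Real.log (m:ℝ) = lm
    generalize Real.log (q:ℝ) = lq
    generalize Real.log ((m:ℝ) - q) = lmq
    have hm1 : (m:ℂ) ≠ 0 := by exact_mod_cast hm0.ne'
    have hq1 : (q:ℂ) ≠ 0 := by exact_mod_cast hq.ne'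
    push_cast
    field_simp
    ring

noncomputable def sg (x : ℝ) : ℝ := -2 * (x + Real.log (1 - x))

lemma sg_pos (x : ℝ) (hx : 0 < x) (hx1 : x < 1) : 0 < sg x := by
  unfold sg
  have := Real.log_lt_sub_one_of_pos (by linarith : 0 < 1 - x) (by linarith)
  linarith

lemma err_lim (q m : ℕ → ℝ) (hq : ∀ᶠ n in atTop, 0 < q n ∧ q n + 1 ≤ m n)
    (hm : Tendsto m atTop atTop) (y : ℝ) (hy : y ∈ Set.Ioc (0 : ℝ) 1)
    (hlim : Tendsto (fun n => q n / m n) atTop (𝓝 y)) (t : ℝ) :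
    Tendsto (fun n => 31 * KK (t / Real.sqrt (sg (q n / m n))) / (m n - q n)) atTop (𝓝 0) := by
  have hKc : Continuous KK := by unfold KK; fun_prop
  rcases lt_or_eq_of_le hy.2 with h | h
  · have hsg : Tendsto (fun n => sg (q n / m n)) atTop (𝓝 (sg y)) := by
      unfold sg
      refine (hlim.add ((hlim.const_sub 1).log (by linarith))).const_mul _
    have hs := (tendsto_const_nhds (x := t)).div hsg.sqrt (Real.sqrt_pos.2 (sg_pos y hy.1 h)).ne'
    have h1 := ((hKc.tendsto _).comp hs).const_mul 31
    refine Tendsto.div_atTop h1 ?_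
    have h2 := hm.atTop_mul_pos (by linarith : 0 < 1 - y) (hlim.const_sub 1)
    refine h2.congr' ?_
    filter_upwards [hq] with n hn
    have : m n ≠ 0 := by linarith
    field_simp
  · subst h
    have hsg : Tendsto (fun n => sg (q n / m n)) atTop atTop := by
      unfold sg
      have h1 : Tendsto (fun n => 1 - q n / m n) atTop (𝓝[>] 0) := by
        rw [tendsto_nhdsWithin_iff]
        refine ⟨by simpa using hlim.const_sub 1, ?_⟩
        filter_upwards [hq] with n hn
        have : q n / m n < 1 := by rw [div_lt_one (by linarith)]; linarith
        simpa using this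
      have h2 := Real.tendsto_log_nhdsGT_zero.comp h1
      exact (hlim.add_atBot h2).const_mul_atBot_of_neg (by norm_num)
    have hs : Tendsto (fun n => t / Real.sqrt (sg (q n / m n))) atTop (𝓝 0) :=
      tendsto_const_nhds.div_atTop (Real.tendsto_sqrt_atTop.comp hsg)
    have h1 := ((hKc.tendsto _).comp hs).const_mul 31
    have h0 : KK 0 = 0 := by simp [KK]
    rw [h0, mul_zero] at h1
    refine squeeze_zero' ?_ ?_ h1
    · filter_upwards [hq] with n hn
      have := KK_nonneg (t / Real.sqrt (sg (q n / m n)))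
      apply div_nonneg (by positivity); linarith
    · filter_upwards [hq] with n hn
      have := KK_nonneg (t / Real.sqrt (sg (q n / m n)))
      exact div_le_self (by positivity) (by linarith)

/-- Jiang–Yang, Theorem 1: CLT for the log likelihood ratio statistic of the
sphericity test when `p/n → y ∈ (0,1]`.  Here `W = Zᵀ Z` with `Z` an
`(n−1) × p` matrix of i.i.d. `N(0,1)` entries, `V_n = det W · (tr W / p)^{−p}`,
and `(log V_n − μ_n)/σ_n ⇒ N(0,1)` (weak convergence tested against bounded
continuous functions). -/
theorem stmt_6 (p : ℕ → ℕ)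
    (hp : ∀ n, 3 ≤ n → 0 < p n ∧ p n + 1 < n)
    (y : ℝ) (hy : y ∈ Set.Ioc (0 : ℝ) 1)
    (hlim : Tendsto (fun n => (p n : ℝ) / n) atTop (𝓝 y))
    (μn σn : ℕ → ℝ)
    (hμ : ∀ n : ℕ, μn n =
      -(p n : ℝ) - ((n : ℝ) - p n - 3 / 2) * Real.log (1 - (p n : ℝ) / ((n : ℝ) - 1)))
    (hσ : ∀ n : ℕ, σn n =
      Real.sqrt (-2 * ((p n : ℝ) / ((n : ℝ) - 1)
        + Real.log (1 - (p n : ℝ) / ((n : ℝ) - 1))))) :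
    ∀ f : BoundedContinuousFunction ℝ ℝ,
      Tendsto (fun n : ℕ =>
          ∫ ω : Fin (n - 1) × Fin (p n) → ℝ,
            f ((logSphericityStat (n - 1) (p n) ω - μn n) / σn n)
            ∂(Measure.pi fun _ => gaussianReal 0 1))
        atTop (𝓝 (∫ x, f x ∂(gaussianReal 0 1))) := by
  have hmeas : ∀ n, Measurable (fun ω : Fin (n - 1) × Fin (p n) → ℝ =>
      (logSphericityStat (n - 1) (p n) ω - μn n) / σn n) := fun n =>
    ((logS_meas _ _).sub_const _).div_const _
  let P : ℕ → ProbabilityMeasure ℝ := fun n =>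
    ⟨(Measure.pi fun _ : Fin (n - 1) × Fin (p n) => gaussianReal 0 1).map
      (fun ω => (logSphericityStat (n - 1) (p n) ω - μn n) / σn n),
      Measure.isProbabilityMeasure_map (hmeas n).aemeasurable⟩
  let P0 : ProbabilityMeasure ℝ := ⟨gaussianReal 0 1, inferInstance⟩
  have key : Tendsto P atTop (𝓝 P0) := by
    apply ProbabilityMeasure.tendsto_of_tendsto_charFun
    intro t
    have hcf0 : charFun (P0 : Measure ℝ) t = Complex.exp (-((t^2/2 : ℝ) : ℂ)) := by
      change charFun (gaussianReal 0 1) t = _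
      rw [charFun_gaussianReal]
      congr 1
      push_cast
      ring
    have hcf : ∀ n, 3 ≤ n → ∃ E : ℂ, ‖E‖ ≤ 31 * KK (t / Real.sqrt (sg (p n / ((n:ℝ) - 1)))) / (((n:ℝ) - 1) - p n) ∧
        charFun (P n : Measure ℝ) t = Complex.exp (-((t^2/2 : ℝ) : ℂ) + E) := by
      intro n hn
      obtain ⟨hp1, hp2⟩ := hp n hn
      have hcast : ((n - 1 : ℕ) : ℝ) = (n:ℝ) - 1 := by
        rw [Nat.cast_sub (by omega), Nat.cast_one]
      have hσ' : σn n = Real.sqrt (sg (p n / ((n:ℝ) - 1))) := hσ n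
      have hp2' : (p n : ℝ) + 1 < n := by exact_mod_cast hp2
      have hp1' : (0:ℝ) < p n := by exact_mod_cast hp1
      have hsgpos : 0 < sg (p n / ((n:ℝ) - 1)) := by
        apply sg_pos
        · apply div_pos hp1'; linarith
        · rw [div_lt_one (by linarith)]; linarith
      have hσpos : 0 < σn n := by rw [hσ']; exact Real.sqrt_pos.2 hsgpos
      have hσsq : (σn n)^2 = sg (p n / ((n:ℝ) - 1)) := by rw [hσ']; exact Real.sq_sqrt hsgpos.le
      obtain ⟨E, hE1, hE2⟩ := char_exp (n - 1) (p n) hp1 (by omega) (t / σn n)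
      rw [hcast, hσ'] at hE1
      refine ⟨E, hE1, ?_⟩
      change charFun ((Measure.pi fun _ : Fin (n - 1) × Fin (p n) => gaussianReal 0 1).map
        (fun ω => (logSphericityStat (n - 1) (p n) ω - μn n) / σn n)) t = _
      rw [charFun_apply_real, integral_map (hmeas n).aemeasurable (by fun_prop)]
      have e1 : ∀ ω : Fin (n - 1) × Fin (p n) → ℝ,
          Complex.exp (t * ((logSphericityStat (n - 1) (p n) ω - μn n) / σn n : ℝ) * Complex.I) =
          Complex.exp (-(Complex.I * (t / σn n : ℝ) * μn n)) *
            Complex.exp (Complex.I * (t / σn n : ℝ) * logSphericityStat (n - 1) (p n) ω) := by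
        intro ω
        rw [← Complex.exp_add]
        congr 1
        push_cast
        ring
      simp_rw [e1]
      rw [integral_const_mul, hE2, ← Complex.exp_add]
      congr 1
      rw [hcast]
      have e2 : (t / σn n)^2 * (-Real.log (1 - p n / ((n:ℝ) - 1)) - p n / ((n:ℝ) - 1)) = t^2/2 := by
        have : -Real.log (1 - p n / ((n:ℝ) - 1)) - p n / ((n:ℝ) - 1) = (σn n)^2 / 2 := by
          rw [hσsq]; unfold sg; ring
        rw [this]
        field_simp
      rw [e2, hμ n]
      generalize Real.log (1 - (p n:ℝ) / ((n:ℝ) - 1)) = l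
      push_cast
      ring
    choose! E hE1 hE2 using hcf
    have hErr := err_lim (fun n => (p n : ℝ)) (fun n => (n:ℝ) - 1) (by
        filter_upwards [eventually_ge_atTop 3] with n hn
        obtain ⟨a, b⟩ := hp n hn
        have b' : (p n : ℝ) + 1 + 1 ≤ n := by exact_mod_cast b
        exact ⟨by exact_mod_cast a, by linarith⟩)
      (tendsto_atTop_add_const_right _ _ tendsto_natCast_atTop_atTop) y hy (by
        have h1 : Tendsto (fun n : ℕ => (n:ℝ) / ((n:ℝ) - 1)) atTop (𝓝 1) := by
          have h2 : Tendsto (fun n : ℕ => 1 - 1 / (n:ℝ)) atTop (𝓝 (1 - 0)) :=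
            tendsto_one_div_atTop_nhds_zero_nat.const_sub 1
          have h3 := h2.inv₀ (by norm_num)
          simp only [sub_zero, inv_one] at h3
          refine h3.congr' ?_
          filter_upwards [eventually_ge_atTop 3] with n hn
          have : (3:ℝ) ≤ n := by exact_mod_cast hn
          have h4 : (n:ℝ) - 1 ≠ 0 := by linarith
          rw [one_sub_div (by linarith), inv_div]
        have h5 := hlim.mul h1
        rw [mul_one] at h5
        refine h5.congr' ?_
        filter_upwards [eventually_ge_atTop 3] with n hn
        have : (3:ℝ) ≤ n := by exact_mod_cast hn
        exact div_mul_div_cancel₀ (by linarith)) t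
    have hE0 : Tendsto E atTop (𝓝 0) := by
      apply squeeze_zero_norm' _ hErr
      filter_upwards [eventually_ge_atTop 3] with n hn
      exact hE1 n hn
    rw [hcf0]
    have h6 := (Complex.continuous_exp.tendsto _).comp (hE0.const_add (-((t^2/2 : ℝ) : ℂ)))
    rw [add_zero] at h6
    refine h6.congr' ?_
    filter_upwards [eventually_ge_atTop 3] with n hn
    exact (hE2 n hn).symm
  intro f
  have := ProbabilityMeasure.tendsto_iff_forall_integral_tendsto.1 key f
  refine this.congr fun n => ?_
  exact integral_map (hmeas n).aemeasurable f.continuous.aestronglyMeasurable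
end
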